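/- Let f : {0,1}ⁿ → Z/8 be given by f(x) = 4·xᵀA_up x + bᵀx (mod 8), where A_up is the strictly upper-triangular part of a symmetric GF(2) matrix A and b ∈ (Z/8)ⁿ. For each i, the number of distinct subfunctions f[a₁/x₁,...,a_{i-1}/x_{i-1}] : {0,1}^{n-i+1} → Z/8 obtained over all assignments (a₁,...,a_{i-1}) ∈ {0,1}^{i-1} is at most 8·2^{r_i}, where r_i = rank_{GF(2)}(A[{1,...,i-1},{i,...,n}]). -/

import Mathlib

/-- Multiplication by four, as an additive map from GF(2) to `Z/8`. -/
def phi8 : ZMod 2 →+ ZMod 8 where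
  toFun t := 4 * ((t.val : ℕ) : ZMod 8)
  map_zero' := by decide
  map_add' := by decide

lemma phi8_mul3 : ∀ a x y : ZMod 2,
    4 * (((a.val : ℕ) : ZMod 8) * ((x.val : ℕ) : ZMod 8) * ((y.val : ℕ) : ZMod 8)) =
      phi8 (a * x * y) := by decide

/-- Let `f(x) = 4·xᵀA_up x + bᵀx (mod 8)` with `A` a symmetric GF(2)
matrix with zero diagonal, `A_up` its strict upper triangle and `b ∈ (Z/8)ⁿ`.
For each prefix length `p = i - 1`, the number of distinct subfunctions obtained
by substituting the first `p` variables is at most `8·2^{r}`, where `r` is the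
GF(2)-rank of `A[{0,...,p-1}, {p,...,n-1}]`. -/
theorem stmt7 (n p : ℕ) (hp : p ≤ n)
    (A : Matrix (Fin n) (Fin n) (ZMod 2)) (hA : A.IsSymm) (hdiag : ∀ i, A i i = 0)
    (b : Fin n → ZMod 8)
    (f : (Fin n → ZMod 2) → ZMod 8)
    (hf : f = fun x =>
      4 * (∑ j : Fin n, ∑ k : Fin n,
            if j < k then
              (((A j k).val : ℕ) : ZMod 8) * (((x j).val : ℕ) : ZMod 8) *
                (((x k).val : ℕ) : ZMod 8)
            else 0) +
      ∑ j : Fin n, b j * (((x j).val : ℕ) : ZMod 8)) :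
    Set.ncard { g : (Fin (n - p) → ZMod 2) → ZMod 8 |
      ∃ a : Fin p → ZMod 2,
        g = fun y => f (fun j : Fin n =>
          if h : (j : ℕ) < p then a ⟨(j : ℕ), h⟩
          else y ⟨(j : ℕ) - p, by have := j.isLt; omega⟩) } ≤
    8 * 2 ^ (Matrix.of fun (j : Fin p) (k : Fin (n - p)) =>
        A ⟨(j : ℕ), lt_of_lt_of_le j.isLt hp⟩
          ⟨p + (k : ℕ), by have := k.isLt; omega⟩).rank := by
  classical
  set M : Matrix (Fin p) (Fin (n - p)) (ZMod 2) := Matrix.of fun j k =>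
        A ⟨(j : ℕ), lt_of_lt_of_le j.isLt hp⟩
          ⟨p + (k : ℕ), by have := k.isLt; omega⟩ with hM
  let iL : Fin p → Fin n := fun j => ⟨(j : ℕ), lt_of_lt_of_le j.isLt hp⟩
  let iR : Fin (n - p) → Fin n := fun k => ⟨p + (k : ℕ), by have := k.isLt; omega⟩
  have hsum : ∀ {R : Type} [AddCommMonoid R] (F : Fin n → R),
      ∑ j, F j = ∑ j, F (iL j) + ∑ k, F (iR k) := by
    intro R _ F
    let e : Fin p ⊕ Fin (n - p) ≃ Fin n :=
      finSumFinEquiv.trans (finCongr (by omega))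
    rw [← e.sum_comp, Fintype.sum_sum_type]
    rfl
  let C : (Fin p → ZMod 2) → ZMod 8 := fun a =>
    phi8 (∑ j, ∑ k, if iL j < iL k then A (iL j) (iL k) * a j * a k else 0) +
      ∑ j, b (iL j) * (((a j).val : ℕ) : ZMod 8)
  let D : (Fin (n - p) → ZMod 2) → ZMod 8 := fun y =>
    phi8 (∑ j, ∑ k, if iR j < iR k then A (iR j) (iR k) * y j * y k else 0) +
      ∑ j, b (iR j) * (((y j).val : ℕ) : ZMod 8)
  have hf2 : ∀ x, f x = phi8 (∑ j, ∑ k, if j < k then A j k * x j * x k else 0) +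
      ∑ j, b j * (((x j).val : ℕ) : ZMod 8) := by
    intro x
    rw [hf]
    simp only [map_sum, Finset.mul_sum]
    congr 1
    refine Finset.sum_congr rfl fun j _ => Finset.sum_congr rfl fun k _ => ?_
    split_ifs
    · exact phi8_mul3 _ _ _
    · simp
  have key : ∀ (a : Fin p → ZMod 2) (y : Fin (n - p) → ZMod 2),
      f (fun j : Fin n =>
          if h : (j : ℕ) < p then a ⟨(j : ℕ), h⟩
          else y ⟨(j : ℕ) - p, by have := j.isLt; omega⟩) =
        C a + D y + phi8 (∑ k, M.transpose.mulVec a k * y k) := by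
    intro a y
    set x : Fin n → ZMod 2 := (fun j : Fin n =>
          if h : (j : ℕ) < p then a ⟨(j : ℕ), h⟩
          else y ⟨(j : ℕ) - p, by have := j.isLt; omega⟩) with hx
    have hxL : ∀ j, x (iL j) = a j := by
      intro j; simp [hx, iL]
    have hxR : ∀ j, x (iR j) = y j := by
      intro j; simp [hx, iR]
    have hLR : ∀ j k, iL j < iR k := by
      intro j k; have := j.isLt; simp only [iL, iR, Fin.mk_lt_mk]; omega
    have hRL : ∀ j k, ¬ iR j < iL k := fun j k => (hLR k j).not_gt
    have hmix : ∑ k, M.transpose.mulVec a k * y k =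
        ∑ j, ∑ k, A (iL j) (iR k) * a j * y k := by
      rw [Finset.sum_comm]
      refine Finset.sum_congr rfl fun k _ => ?_
      simp only [Matrix.mulVec, dotProduct, Finset.sum_mul]
      rfl
    rw [hf2, hmix]
    simp only [hsum, hxL, hxR, hLR, hRL, if_true, if_false, Finset.sum_const_zero,
      Finset.sum_add_distrib, map_add, C, D, map_zero]
    ring
  let V := LinearMap.range M.transpose.mulVecLin
  let G : ZMod 8 × V → ((Fin (n - p) → ZMod 2) → ZMod 8) := fun q y =>
    q.1 + D y + phi8 (∑ k, q.2.1 k * y k)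
  have hsub : { g : (Fin (n - p) → ZMod 2) → ZMod 8 |
      ∃ a : Fin p → ZMod 2,
        g = fun y => f (fun j : Fin n =>
          if h : (j : ℕ) < p then a ⟨(j : ℕ), h⟩
          else y ⟨(j : ℕ) - p, by have := j.isLt; omega⟩) } ⊆ Set.range G := by
    rintro g ⟨a, rfl⟩
    refine ⟨(C a, ⟨M.transpose.mulVec a, a, rfl⟩), ?_⟩
    funext y
    exact (key a y).symm
  refine (Set.ncard_le_ncard hsub (Set.toFinite _)).trans ?_
  have h1 : (Set.range G).ncard ≤ Nat.card (ZMod 8 × V) := by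
    rw [← Set.image_univ, ← Set.ncard_univ]
    exact Set.ncard_image_le (Set.toFinite _)
  refine h1.trans (le_of_eq ?_)
  rw [Nat.card_prod, Module.natCard_eq_pow_finrank (K := ZMod 2) (V := V), Nat.card_zmod,
    Nat.card_zmod, ← Matrix.rank_transpose M]
  rfl
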